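/- In the setting of the structure equation, assume additionally that φ(0, x) = x for all x ∈ ℝ³, that β(p(t))(p′(t)) = 0 (the curve p is horizontal at the parameter t), and that for some s > 0 one has dβ(φ(s′, p(t)))(X(φ(s′, p(t))), w(s′, t)) > 0 for all s′ ∈ (0, s]. Then κ(s, t) > 0, i.e., β(φ(s, p(t)))(w(s, t)) > 0. -/

import Mathlib

section FlowVariation

variable {E F : Type*} [NormedAddCommGroup E] [NormedSpace ℝ E]
  [NormedAddCommGroup F] [NormedSpace ℝ F]

/-- The first variation of a flow solves the linearized equation. -/
theorem hasDerivAt_fderiv_flow {X : E → E} {φ : ℝ × E → E}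
    (hX : Differentiable ℝ X) (hφ : ContDiff ℝ 2 φ)
    (hflow : ∀ s x, deriv (fun s' => φ (s', x)) s = X (φ (s, x))) (s : ℝ) (x v : E) :
    HasDerivAt (fun s' => fderiv ℝ φ (s', x) (0, v))
      (fderiv ℝ X (φ (s, x)) (fderiv ℝ φ (s, x) (0, v))) s := by
  have hφd : Differentiable ℝ φ := hφ.differentiable (by norm_num)
  have hDφ : Differentiable ℝ (fderiv ℝ φ) :=
    (hφ.fderiv_right (m := 1) (by norm_num)).differentiable (by norm_num)
  have hγ : HasDerivAt (fun s' : ℝ => (s', x)) ((1 : ℝ), (0 : E)) s :=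
    (hasDerivAt_id s).prodMk (hasDerivAt_const s x)
  have hcomp : (fun q => fderiv ℝ φ q ((1 : ℝ), (0 : E))) = fun q => X (φ q) := by
    funext q
    rw [← hflow q.1 q.2]
    have hq : HasDerivAt (fun s' : ℝ => (s', q.2)) ((1 : ℝ), (0 : E)) q.1 :=
      (hasDerivAt_id q.1).prodMk (hasDerivAt_const q.1 q.2)
    exact ((hφd q).hasFDerivAt.comp_hasDerivAt q.1 hq).deriv.symm
  have hmixed : fderiv ℝ (fderiv ℝ φ) (s, x) (0, v) (1, 0) =
      fderiv ℝ X (φ (s, x)) (fderiv ℝ φ (s, x) (0, v)) := by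
    have h₁ := ((hDφ (s, x)).hasFDerivAt.clm_apply
      (hasFDerivAt_const ((1 : ℝ), (0 : E)) (s, x)))
    rw [hcomp] at h₁
    have h₂ := (hX (φ (s, x))).hasFDerivAt.comp (s, x) (hφd (s, x)).hasFDerivAt
    simpa using DFunLike.congr_fun (h₁.unique h₂) (0, v)
  have hsymm : IsSymmSndFDerivAt ℝ φ (s, x) :=
    hφ.contDiffAt.isSymmSndFDerivAt (by simp)
  have hD : HasDerivAt (fun s' => fderiv ℝ φ (s', x))
      (fderiv ℝ (fderiv ℝ φ) (s, x) (1, 0)) s :=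
    (hDφ (s, x)).hasFDerivAt.comp_hasDerivAt s hγ
  rw [← hmixed, ← hsymm.eq]
  simpa using hD.clm_apply (hasDerivAt_const s ((0 : ℝ), v))

/-- If `X` lies in the kernel of `β`, then along the flow of `X` the value of `β` on the first
variation has derivative `dβ(X, ·)`. -/
theorem hasDerivAt_apply_fderiv_flow {β : E → E →L[ℝ] F} {X : E → E} {φ : ℝ × E → E}
    (hβ : Differentiable ℝ β) (hX : Differentiable ℝ X) (hφ : ContDiff ℝ 2 φ)
    (hβX : ∀ x, β x (X x) = 0)
    (hflow : ∀ s x, deriv (fun s' => φ (s', x)) s = X (φ (s, x))) (s : ℝ) (x v : E) :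
    HasDerivAt (fun s' => β (φ (s', x)) (fderiv ℝ φ (s', x) (0, v)))
      (fderiv ℝ β (φ (s, x)) (X (φ (s, x))) (fderiv ℝ φ (s, x) (0, v)) -
        fderiv ℝ β (φ (s, x)) (fderiv ℝ φ (s, x) (0, v)) (X (φ (s, x)))) s := by
  have hφs : HasDerivAt (fun s' => φ (s', x)) (X (φ (s, x))) s := by
    rw [← hflow]
    exact ((hφ.differentiable (by norm_num)).comp
      (differentiable_id.prodMk (differentiable_const x)) s).hasDerivAt
  have hker : ∀ y u, fderiv ℝ β y u (X y) + β y (fderiv ℝ X y u) = 0 := by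
    intro y u
    have h := (hβ y).hasFDerivAt.clm_apply (hX y).hasFDerivAt
    simp only [hβX] at h
    have := DFunLike.congr_fun (h.unique (hasFDerivAt_const (0 : F) y)) u
    simpa [add_comm] using this
  convert ((hβ _).hasFDerivAt.comp_hasDerivAt s hφs).clm_apply
    (hasDerivAt_fderiv_flow hX hφ hflow s x v) using 1
  · rfl
  · rw [sub_eq_add_neg, neg_eq_of_add_eq_zero_right (hker _ _)]
    rfl

end FlowVariation

/-- in the setting of the structure equation, if moreover `φ(0, ·) = id`, the
curve `p` is horizontal at the parameter `t`, and `dβ(X, w) > 0` along the flow for all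
`s' ∈ (0, s]`, then the holonomy coefficient `κ(s, t) = β(φ(s, p t))(w(s,t))` is positive. -/
theorem stmt_9
    (β : EuclideanSpace ℝ (Fin 3) → (EuclideanSpace ℝ (Fin 3) →L[ℝ] ℝ))
    (X : EuclideanSpace ℝ (Fin 3) → EuclideanSpace ℝ (Fin 3))
    (φ : ℝ × EuclideanSpace ℝ (Fin 3) → EuclideanSpace ℝ (Fin 3))
    (p : ℝ → EuclideanSpace ℝ (Fin 3))
    (hβ : ContDiff ℝ 1 β) (hX : ContDiff ℝ 1 X) (hφ : ContDiff ℝ 2 φ)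
    (hp : ContDiff ℝ 1 p)
    (hβX : ∀ x, β x (X x) = 0)
    (hflow : ∀ s x, deriv (fun s' => φ (s', x)) s = X (φ (s, x)))
    (hid : ∀ x, φ (0, x) = x)
    (t s : ℝ) (hs : 0 < s)
    (hhor : β (p t) (deriv p t) = 0)
    (hpos : ∀ s' ∈ Set.Ioc (0:ℝ) s,
      0 < fderiv ℝ β (φ (s', p t)) (X (φ (s', p t))) (deriv (fun t' => φ (s', p t')) t) -
          fderiv ℝ β (φ (s', p t)) (deriv (fun t' => φ (s', p t')) t) (X (φ (s', p t)))) :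
    0 < β (φ (s, p t)) (deriv (fun t' => φ (s, p t')) t) := by
  have hw : ∀ s', deriv (fun t' => φ (s', p t')) t =
      fderiv ℝ φ (s', p t) (0, deriv p t) := fun s' =>
    ((hφ.differentiable (by norm_num) _).hasFDerivAt.comp_hasDerivAt t
      ((hasDerivAt_const t s').prodMk
        (hp.differentiable (by norm_num) t).hasDerivAt)).deriv
  have hκ := fun s' => hasDerivAt_apply_fderiv_flow (hβ.differentiable (by norm_num))
    (hX.differentiable (by norm_num)) hφ hβX hflow s' (p t) (deriv p t)
  have hκ₀ : β (φ (0, p t)) (fderiv ℝ φ (0, p t) (0, deriv p t)) = 0 := by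
    rw [← hw]
    simpa only [hid] using hhor
  have hmono := strictMonoOn_of_deriv_pos (convex_Icc 0 s)
    (fun s' _ => (hκ s').continuousAt.continuousWithinAt) (fun s' hs' => by
      rw [interior_Icc] at hs'
      rw [(hκ s').deriv, ← hw]
      exact hpos s' ⟨hs'.1, hs'.2.le⟩)
  have hlt := hmono (Set.left_mem_Icc.2 hs.le) (Set.right_mem_Icc.2 hs.le) hs
  rw [hw]
  exact hκ₀.symm.trans_lt hlt
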